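/- For α > 1, σ > 0 and z ∈ ℝ, the GAGA hyperparameter sequence b_0 = 0, b_{k+1} = f(b_k) with f(b) = α(σ+b)²/(z² + σ + b) tends to +∞ as k → ∞ if and only if z² < σ (√α + √(α − 1))². -/

import Mathlib

open Filter

/-- The scalar GAGA hyperparameter recursion: `b₀ = 0`,
`b_{k+1} = α (σ + b_k)² / (z² + σ + b_k)`. -/
noncomputable def gagaB (α σ z : ℝ) : ℕ → ℝ
  | 0 => 0
  | k + 1 => α * (σ + gagaB α σ z k) ^ 2 / (z ^ 2 + σ + gagaB α σ z k)

theorem gagaB_succ (α σ z : ℝ) (k : ℕ) :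
    gagaB α σ z (k + 1) =
      α * (σ + gagaB α σ z k) ^ 2 / (z ^ 2 + σ + gagaB α σ z k) := rfl

theorem gagaB_nonneg {α σ : ℝ} (z : ℝ) (hα : 0 ≤ α) (hσ : 0 ≤ σ) (k : ℕ) :
    0 ≤ gagaB α σ z k := by
  induction k with
  | zero => exact le_rfl
  | succ k ih =>
    rw [gagaB_succ]
    positivity

/-- If the update map lies strictly above the diagonal on `[0, ∞)`, the sequence diverges. -/
theorem gagaB_tendsto_atTop {α σ z : ℝ} (hα : 0 ≤ α) (hσ : 0 < σ)
    (h : ∀ b, 0 ≤ b → b < α * (σ + b) ^ 2 / (z ^ 2 + σ + b)) :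
    Tendsto (gagaB α σ z) atTop atTop := by
  have hnonneg := gagaB_nonneg z hα hσ.le
  have hmono : Monotone (gagaB α σ z) :=
    monotone_nat_of_le_succ fun k => (h _ (hnonneg k)).le
  rcases tendsto_atTop_of_monotone hmono with htop | ⟨l, hl⟩
  · exact htop
  · have hl0 : 0 ≤ l := ge_of_tendsto' hl hnonneg
    have hne : z ^ 2 + σ + l ≠ 0 := by positivity
    have hlim : Tendsto (fun k => gagaB α σ z (k + 1)) atTop
        (nhds (α * (σ + l) ^ 2 / (z ^ 2 + σ + l))) :=
      (((hl.const_add σ).pow 2).const_mul α).div (hl.const_add (z ^ 2 + σ)) hne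
    have heq := tendsto_nhds_unique (hl.comp (tendsto_add_atTop_nat 1)) hlim
    exact absurd heq (h l hl0).ne

/-- A nonnegative `c` that the update map does not increase bounds the sequence. -/
theorem gagaB_le {α σ z c : ℝ} (hα : 0 ≤ α) (hσ : 0 < σ) (hc : 0 ≤ c)
    (h : α * (σ + c) ^ 2 / (z ^ 2 + σ + c) ≤ c) (k : ℕ) :
    gagaB α σ z k ≤ c := by
  induction k with
  | zero => exact hc
  | succ k ih =>
    refine le_trans ?_ h
    rw [gagaB_succ]
    have hb := gagaB_nonneg z hα hσ.le k
    generalize gagaB α σ z k = b at ih hb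
    rw [div_le_div_iff₀ (by positivity) (by positivity)]
    have hkey : (σ + b) ^ 2 * (z ^ 2 + σ + c) ≤ (σ + c) ^ 2 * (z ^ 2 + σ + b) := by
      have h1 : (σ + b) ^ 2 * z ^ 2 ≤ (σ + c) ^ 2 * z ^ 2 := by gcongr
      have h2 : (σ + b) * (σ + c) * (σ + b) ≤ (σ + b) * (σ + c) * (σ + c) := by gcongr
      linarith
    linarith [mul_le_mul_of_nonneg_left hkey hα]

/-- For `α > 1`, the GAGA hyperparameter sequence tends to `+∞`
iff `z² < σ(√α + √(α−1))²`. -/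
theorem gaga_diverges_iff (α σ z : ℝ) (hα : 1 < α) (hσ : 0 < σ) :
    Tendsto (gagaB α σ z) atTop atTop ↔
      z ^ 2 < σ * (Real.sqrt α + Real.sqrt (α - 1)) ^ 2 := by
  obtain ⟨r, hr, rfl⟩ : ∃ r : ℝ, 0 < r ∧ r ^ 2 = σ :=
    ⟨√σ, Real.sqrt_pos.2 hσ, Real.sq_sqrt hσ.le⟩
  have hA2 : √α ^ 2 = α := Real.sq_sqrt (by linarith)
  have hB2 : √(α - 1) ^ 2 = α - 1 := Real.sq_sqrt (by linarith)
  have hBA : √(α - 1) < √α := Real.sqrt_lt_sqrt (by linarith) (by linarith)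
  have hB : 0 < √(α - 1) := Real.sqrt_pos.2 (by linarith)
  generalize √α = A at *
  generalize √(α - 1) = B at *
  have hA : 0 < A := hB.trans hBA
  have hfactor : |z| ^ 2 - r ^ 2 - 2 * B * r * |z| =
      (|z| - r * (A + B)) * (|z| + r * (A - B)) := by
    linear_combination r ^ 2 * (hA2 - hB2)
  have hα0 : 0 ≤ α := by linarith
  have hw : 0 ≤ |z| := abs_nonneg z
  have hpos : 0 < |z| + r * (A - B) := by
    have := mul_pos hr (sub_pos.2 hBA)
    linarith
  rw [← mul_pow, ← sq_abs z, sq_lt_sq₀ hw (by positivity)]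
  constructor
  · intro htop
    by_contra! hle
    have hnonneg : 0 ≤ |z| ^ 2 - r ^ 2 - 2 * B * r * |z| := by
      rw [hfactor]
      exact mul_nonneg (sub_nonneg.2 hle) hpos.le
    obtain ⟨u, hu⟩ : ∃ u, B * u = r * |z| := ⟨r * |z| / B, by field_simp⟩
    have hru : r ^ 2 ≤ u := by
      refine le_of_mul_le_mul_left ?_ hB
      rw [hu]
      nlinarith [mul_pos hr hA, mul_pos hr hB]
    have hfix : α * (r ^ 2 + (u - r ^ 2)) ^ 2 / (z ^ 2 + r ^ 2 + (u - r ^ 2)) ≤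
        u - r ^ 2 := by
      have hu0 : 0 < u := by nlinarith
      rw [div_le_iff₀ (by nlinarith [sq_nonneg z]), ← sq_abs z]
      have h1 := mul_nonneg hnonneg hu0.le
      have h2 : B ^ 2 * u ^ 2 = r ^ 2 * |z| ^ 2 := by rw [← mul_pow, hu, mul_pow]
      have h3 : B * r * |z| * u = r ^ 2 * |z| ^ 2 := by
        linear_combination r * |z| * hu
      have h4 : α * u ^ 2 = u ^ 2 + r ^ 2 * |z| ^ 2 := by
        linear_combination h2 - u ^ 2 * hB2
      linarith
    obtain ⟨k, hk⟩ := (htop.eventually_gt_atTop (u - r ^ 2)).exists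
    exact absurd (gagaB_le hα0 hσ (sub_nonneg.2 hru) hfix k) (not_le.2 hk)
  · intro hlt
    refine gagaB_tendsto_atTop hα0 hσ fun b hb => ?_
    have hneg : |z| ^ 2 - r ^ 2 - 2 * B * r * |z| < 0 := by
      rw [hfactor]
      exact mul_neg_of_neg_of_pos (sub_neg.2 hlt) hpos
    rw [lt_div_iff₀ (by positivity), ← sq_abs z]
    have hu0 : 0 < r ^ 2 + b := by positivity
    have h1 := mul_neg_of_neg_of_pos hneg hu0
    have h2 := sq_nonneg (B * (r ^ 2 + b) - r * |z|)
    have h3 : B ^ 2 * (r ^ 2 + b) ^ 2 = (α - 1) * (r ^ 2 + b) ^ 2 := by rw [hB2]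
    linarith
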